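/- Let V be a Hilbert space and V_1, ..., V_m closed subspaces of V such that V = V_1 + V_2 + ... + V_m (every element of V is a finite sum of elements of the V_i). Then the operator norm of the composition P_{V_m^⊥} ∘ P_{V_{m-1}^⊥} ∘ ... ∘ P_{V_1^⊥} is strictly less than 1. -/

import Mathlib

open Submodule

variable {V : Type*} [NormedAddCommGroup V] [InnerProductSpace ℝ V] [CompleteSpace V]

/-- Orthogonal projection of `V` onto the orthogonal complement `Wᗮ` of a subspace `W`,
viewed as a continuous linear map `V →L[ℝ] V`. -/
noncomputable def projPerp (W : Submodule ℝ V) : V →L[ℝ] V :=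
  letI : CompleteSpace Wᗮ := (Submodule.isClosed_orthogonal W).completeSpace_coe
  letI : HasOrthogonalProjection Wᗮ := HasOrthogonalProjection.ofCompleteSpace Wᗮ
  Wᗮ.subtypeL.comp (orthogonalProjection Wᗮ)

/-- The composition `P_{V_m^⊥} ∘ ⋯ ∘ P_{V_1^⊥}`. -/
noncomputable def compProjPerp {m : ℕ} (Vsub : Fin m → Submodule ℝ V) : V →L[ℝ] V :=
  ((List.ofFn fun i => projPerp (Vsub i)).reverse).prod

theorem inner_projPerp_eq_zero {W : Submodule ℝ V} {f : V} (hf : f ∈ W) (x : V) :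
    inner ℝ f (projPerp W x) = 0 := by
  have : CompleteSpace Wᗮ := (Submodule.isClosed_orthogonal W).completeSpace_coe
  exact Submodule.inner_right_of_mem_orthogonal hf (orthogonalProjectionOnto Wᗮ x).2

theorem norm_sq_eq_projPerp (W : Submodule ℝ V) (x : V) :
    ‖x‖ ^ 2 = ‖projPerp W x‖ ^ 2 + ‖x - projPerp W x‖ ^ 2 := by
  have : CompleteSpace Wᗮ := (Submodule.isClosed_orthogonal W).completeSpace_coe
  have h : inner ℝ (projPerp W x) (x - projPerp W x) = 0 :=
    Submodule.inner_right_of_mem_orthogonal (orthogonalProjectionOnto Wᗮ x).2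
      (Submodule.sub_starProjection_mem_orthogonal (K := Wᗮ) x)
  have h' := norm_add_sq_real (projPerp W x) (x - projPerp W x)
  rw [h, add_sub_cancel] at h'
  linarith

theorem norm_prod_projPerp_sq_le (L : List (Submodule ℝ V)) (x : V) :
    ‖(L.map projPerp).reverse.prod x‖ ^ 2 ≤ ‖x‖ ^ 2 := by
  induction L generalizing x with
  | nil => simp
  | cons W L ih =>
    have h := ih (projPerp W x)
    have h' := norm_sq_eq_projPerp W x
    simp only [List.map_cons, List.reverse_cons, List.prod_append, List.prod_singleton,
      mul_apply_eq_comp]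
    nlinarith [sq_nonneg ‖x - projPerp W x‖]

/-- The loss of squared norm along successive projections onto orthogonal complements controls
the inner products with vectors of the subspaces. -/
theorem inner_sq_le_of_mem (L : List (Submodule ℝ V)) {W : Submodule ℝ V} (hW : W ∈ L)
    {f : V} (hf : f ∈ W) (x : V) :
    (inner ℝ f x) ^ 2 ≤
      ‖f‖ ^ 2 * (L.length * (‖x‖ ^ 2 - ‖(L.map projPerp).reverse.prod x‖ ^ 2)) := by
  induction L generalizing x with
  | nil => simp at hW
  | cons U L ih =>
    have hle := norm_prod_projPerp_sq_le L (projPerp U x)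
    have hx := norm_sq_eq_projPerp U x
    simp only [List.map_cons, List.reverse_cons, List.prod_append, List.prod_singleton,
      mul_apply_eq_comp, List.length_cons, Nat.cast_add, Nat.cast_one]
    set p := projPerp U x with hp
    set D := ‖p‖ ^ 2 - ‖(L.map projPerp).reverse.prod p‖ ^ 2 with hD
    set n : ℝ := (L.length : ℝ) with hn
    have hn0 : 0 ≤ n := Nat.cast_nonneg _
    have hD0 : 0 ≤ D := by linarith
    have htot : ‖x‖ ^ 2 - ‖(L.map projPerp).reverse.prod p‖ ^ 2 = ‖x - p‖ ^ 2 + D := by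
      rw [hx, hD]; ring
    rw [htot]
    have ha : (inner ℝ f (x - p)) ^ 2 ≤ ‖f‖ ^ 2 * ‖x - p‖ ^ 2 := by
      rw [← mul_pow, ← sq_abs]
      exact pow_le_pow_left₀ (abs_nonneg _) (abs_real_inner_le_norm _ _) 2
    have hsplit : inner ℝ f x = inner ℝ f (x - p) + inner ℝ f p := by
      rw [← inner_add_right, sub_add_cancel]
    rw [hsplit]
    have hb : (inner ℝ f p) ^ 2 ≤ ‖f‖ ^ 2 * (n * D) := by
      rcases List.mem_cons.mp hW with rfl | h
      · rw [hp, inner_projPerp_eq_zero hf, zero_pow two_ne_zero]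
        positivity
      · exact ih h p
    generalize inner ℝ f (x - p) = a at ha ⊢
    generalize inner ℝ f p = b at hb ⊢
    set A := ‖f‖ ^ 2 * ‖x - p‖ ^ 2 with hA
    set B := ‖f‖ ^ 2 * D with hB
    have hA0 : 0 ≤ A := by positivity
    have hB0 : 0 ≤ B := by positivity
    have hb' : b ^ 2 ≤ n * B := by rw [hB]; linarith
    have hab : 2 * (a * b) ≤ n * A + B := by
      refine le_of_sq_le_sq ?_ (by positivity)
      have : a ^ 2 * b ^ 2 ≤ A * (n * B) := mul_le_mul ha hb' (sq_nonneg _) hA0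
      nlinarith [sq_nonneg (n * A - B)]
    calc (a + b) ^ 2 = a ^ 2 + 2 * (a * b) + b ^ 2 := by ring
      _ ≤ A + (n * A + B) + n * B := by linarith
      _ = _ := by rw [hA, hB]; ring

/-- By the open mapping theorem, decompositions along a finite sum of closed subspaces can be
chosen with linearly bounded summands. -/
theorem exists_bounded_decomposition {m : ℕ} (Vsub : Fin m → Submodule ℝ V)
    (hclosed : ∀ i, IsClosed ((Vsub i) : Set V))
    (hsum : ∀ v : V, ∃ f : Fin m → V, (∀ i, f i ∈ Vsub i) ∧ v = ∑ i, f i) :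
    ∃ C : ℝ, 0 < C ∧ ∀ v : V, ∃ f : Fin m → V,
      (∀ i, f i ∈ Vsub i) ∧ v = ∑ i, f i ∧ ∀ i, ‖f i‖ ≤ C * ‖v‖ := by
  have : ∀ i, CompleteSpace (Vsub i) := fun i => (hclosed i).completeSpace_coe
  let S : (∀ i, Vsub i) →L[ℝ] V :=
    ∑ i, (Vsub i).subtypeL.comp (ContinuousLinearMap.proj i)
  have hS : ∀ g, S g = ∑ i, (g i : V) := fun g => by simp [S]
  have hsurj : Function.Surjective S := fun v => by
    obtain ⟨f, hf, rfl⟩ := hsum v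
    exact ⟨fun i => ⟨f i, hf i⟩, by simp [hS]⟩
  obtain ⟨C, hC, h⟩ := S.exists_preimage_norm_le hsurj
  refine ⟨C, hC, fun v => ?_⟩
  obtain ⟨g, hg, hgn⟩ := h v
  exact ⟨fun i => g i, fun i => (g i).2, by rw [← hg, hS],
    fun i => (norm_le_pi_norm g i).trans hgn⟩

theorem norm_compProjPerp_lt_one {m : ℕ} (Vsub : Fin m → Submodule ℝ V)
    (hclosed : ∀ i, IsClosed ((Vsub i) : Set V))
    (hsum : ∀ v : V, ∃ f : Fin m → V, (∀ i, f i ∈ Vsub i) ∧ v = ∑ i, f i) :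
    ‖compProjPerp Vsub‖ < 1 := by
  obtain ⟨C, hC, hdec⟩ := exists_bounded_decomposition Vsub hclosed hsum
  have hT : compProjPerp Vsub = ((List.ofFn Vsub).map projPerp).reverse.prod := by
    simp [compProjPerp, List.map_ofFn, Function.comp_def]
  set K : ℝ := (m : ℝ) ^ 3 * C ^ 2 + 1 with hK
  have hK1 : 1 ≤ K := by rw [hK]; linarith [show 0 ≤ (m : ℝ) ^ 3 * C ^ 2 by positivity]
  have hK0 : 0 < K := by linarith
  have key : ∀ x, ‖x‖ ^ 2 ≤ K * (‖x‖ ^ 2 - ‖compProjPerp Vsub x‖ ^ 2) := by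
    intro x
    have hD0 : 0 ≤ ‖x‖ ^ 2 - ‖compProjPerp Vsub x‖ ^ 2 := by
      rw [hT]; linarith [norm_prod_projPerp_sq_le (List.ofFn Vsub) x]
    obtain ⟨f, hf, hxf, hfn⟩ := hdec x
    have hi : ∀ i, (inner ℝ (f i) x) ^ 2 ≤
        C ^ 2 * ‖x‖ ^ 2 * (m * (‖x‖ ^ 2 - ‖compProjPerp Vsub x‖ ^ 2)) := fun i => by
      have h := inner_sq_le_of_mem (List.ofFn Vsub) (List.mem_ofFn.mpr ⟨i, rfl⟩) (hf i) x
      rw [← hT, List.length_ofFn] at h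
      rw [← mul_pow]
      exact h.trans (mul_le_mul_of_nonneg_right
        (pow_le_pow_left₀ (norm_nonneg _) (hfn i) 2) (by positivity))
    generalize ‖x‖ ^ 2 - ‖compProjPerp Vsub x‖ ^ 2 = D at hD0 hi ⊢
    have hxx : ‖x‖ ^ 2 = ∑ i, inner ℝ (f i) x := by
      rw [← sum_inner, ← hxf, real_inner_self_eq_norm_sq]
    have h4 : (‖x‖ ^ 2) ^ 2 ≤ m * (m * (C ^ 2 * ‖x‖ ^ 2 * (m * D))) := by
      calc (‖x‖ ^ 2) ^ 2 = (∑ i, inner ℝ (f i) x) ^ 2 := by rw [← hxx]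
        _ ≤ m * ∑ i, (inner ℝ (f i) x) ^ 2 := by
          simpa using sq_sum_le_card_mul_sum_sq (s := Finset.univ)
            (f := fun i => inner ℝ (f i) x)
        _ ≤ m * (m * (C ^ 2 * ‖x‖ ^ 2 * (m * D))) := by
          gcongr
          simpa using Finset.sum_le_sum fun i (_ : i ∈ Finset.univ) => hi i
    rcases eq_or_lt_of_le (sq_nonneg ‖x‖) with h0 | h0
    · rw [← h0]; positivity
    · refine le_of_mul_le_mul_left ?_ h0
      rw [hK]
      nlinarith [mul_nonneg h0.le hD0]
  have hlt : Real.sqrt (1 - K⁻¹) < 1 := by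
    rw [Real.sqrt_lt' one_pos]
    linarith [inv_pos.mpr hK0]
  refine lt_of_le_of_lt (ContinuousLinearMap.opNorm_le_bound _ (Real.sqrt_nonneg _) fun x => ?_) hlt
  have hnn : 0 ≤ 1 - K⁻¹ := by linarith [inv_le_one_of_one_le₀ hK1]
  refine le_of_sq_le_sq ?_ (by positivity)
  rw [mul_pow, Real.sq_sqrt hnn]
  have h := (inv_mul_le_iff₀ hK0).mpr (key x)
  linarith
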